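/- Let A be a finitely generated residually solvable group, C a proper normal subgroup of A such that the quotient A/C is a perfect group, and φ : A → A a group automorphism. Then the double D = A ∗_{C = φ(C)} A of A over C via φ is meta-residually-solvable but is NOT residually solvable. -/

import Mathlib

open scoped Pointwise

/-- The two maps `C →* A` defining the double `D = A ∗_{C = φ(C)} A`: the first copy of `A`
receives `C` by inclusion, the second copy receives `C` via `φ` followed by inclusion. -/
def doubleMaps {A : Type*} [Group A] (C : Subgroup A) (φ : A ≃* A) :
    Bool → (↥C →* A) :=
  fun b => match b with
  | false => C.subtype
  | true => (φ : A →* A).comp C.subtype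

/-- The double `A ∗_{C = φ(C)} A`: the amalgamated free product (pushout) of two copies of `A`
over `C`, amalgamating `C` in the first copy with `φ(C)` in the second copy via `φ`. -/
abbrev Double {A : Type*} [Group A] (C : Subgroup A) (φ : A ≃* A) : Type _ :=
  Monoid.PushoutI (doubleMaps C φ)

/-- The canonical embedding of the first copy of `A` into the double. -/
def Double.inl {A : Type*} [Group A] (C : Subgroup A) (φ : A ≃* A) : A →* Double C φ :=
  Monoid.PushoutI.of (φ := doubleMaps C φ) false

/-- The canonical embedding of the second copy of `A` into the double. -/
def Double.inr {A : Type*} [Group A] (C : Subgroup A) (φ : A ≃* A) : A →* Double C φ :=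
  Monoid.PushoutI.of (φ := doubleMaps C φ) true

/-- A group is residually solvable if every nontrivial element survives in some solvable
homomorphic image. -/
def ResiduallySolvable (G : Type u) [Group G] : Prop :=
  ∀ g : G, g ≠ 1 → ∃ (S : Type u) (_ : Group S) (f : G →* S), IsSolvable S ∧ f g ≠ 1

theorem ResiduallySolvable.of_injective {G H : Type u} [Group G] [Group H]
    (hH : ResiduallySolvable H) (f : G →* H) (hf : Function.Injective f) :
    ResiduallySolvable G := by
  intro g hg
  obtain ⟨S, _, F, hS, hF⟩ := hH (f g) ((map_ne_one_iff f hf).2 hg)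
  exact ⟨S, _, F.comp f, hS, hF⟩

theorem isSolvable_quotient_derivedSeries (G : Type*) [Group G] (n : ℕ) :
    Group.IsSolvable (G ⧸ derivedSeries G n) := by
  refine (Group.isSolvable_def _).2 ⟨n, ?_⟩
  rw [← map_derivedSeries_eq (QuotientGroup.mk'_surjective (derivedSeries G n)),
    QuotientGroup.map_mk'_self]

theorem residuallySolvable_of_forall_notMem_derivedSeries {G : Type u} [Group G]
    (h : ∀ g : G, g ≠ 1 → ∃ n, g ∉ derivedSeries G n) : ResiduallySolvable G := by
  intro g hg
  obtain ⟨n, hn⟩ := h g hg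
  exact ⟨G ⧸ derivedSeries G n, inferInstance, QuotientGroup.mk' _,
    isSolvable_quotient_derivedSeries G n, by simpa using hn⟩

open scoped commutatorElement in
/-- Let `T` be a decreasing multiplicative filtration of a ring and `ρ` a representation of a group
by elements congruent to `1` modulo `T 1`. Then the `n`-th derived subgroup is represented by
elements congruent to `1` modulo `T (n + 1)`. -/
theorem map_sub_one_mem_of_mem_derivedSeries {G R : Type*} [Group G] [Ring R] (ρ : G →* R)
    (T : ℕ → AddSubgroup R) (hanti : Antitone T) (hone : 1 ∈ T 0)
    (hmul : ∀ a b x y, x ∈ T a → y ∈ T b → x * y ∈ T (a + b))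
    (hρ : ∀ g, ρ g - 1 ∈ T 1) (n : ℕ) :
    ∀ g ∈ derivedSeries G n, ρ g - 1 ∈ T (n + 1) := by
  have hzero (g : G) : ρ g ∈ T 0 := by
    simpa using add_mem (hanti zero_le_one (hρ g)) hone
  induction n with
  | zero => exact fun g _ => hρ g
  | succ n ih =>
    let Γ : Subgroup G :=
      { carrier := {g | ρ g - 1 ∈ T (n + 2)}
        one_mem' := by simp
        mul_mem' := fun {a b} ha hb => by
          have : ρ (a * b) - 1 = (ρ a - 1) * ρ b + (ρ b - 1) := by
            rw [map_mul]; noncomm_ring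
          change ρ (a * b) - 1 ∈ T (n + 2)
          rw [this]
          exact add_mem (hmul _ 0 _ _ ha (hzero b)) hb
        inv_mem' := fun {a} ha => by
          have : ρ a⁻¹ - 1 = -((ρ a - 1) * ρ a⁻¹) := by
            rw [sub_mul, ← map_mul]; simp
          change ρ a⁻¹ - 1 ∈ T (n + 2)
          rw [this]
          exact neg_mem (hmul _ 0 _ _ ha (hzero a⁻¹)) }
    suffices derivedSeries G (n + 1) ≤ Γ from fun g hg => this hg
    rw [derivedSeries_succ, Subgroup.commutator_le]
    intro a ha b hb
    have hcomm : ρ ⁅a, b⁆ - 1 =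
        ((ρ a - 1) * (ρ b - 1) - (ρ b - 1) * (ρ a - 1)) * ρ (b * a)⁻¹ := by
      have h1 : (ρ a - 1) * (ρ b - 1) - (ρ b - 1) * (ρ a - 1) = ρ (a * b) - ρ (b * a) := by
        rw [map_mul, map_mul]; noncomm_ring
      rw [h1, sub_mul, ← map_mul, ← map_mul, mul_inv_cancel, map_one, commutatorElement_def,
        mul_inv_rev]
      simp only [mul_assoc]
    have hle : n + 2 ≤ n + 1 + (n + 1) := by lia
    change ρ ⁅a, b⁆ - 1 ∈ T (n + 2)
    rw [hcomm]
    exact hmul _ 0 _ _ (sub_mem (hanti hle (hmul _ _ _ _ (ih a ha) (ih b hb)))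
      (hanti hle (hmul _ _ _ _ (ih b hb) (ih a ha)))) (hzero _)

namespace FreeGroup

variable {ι : Type*}

/-- The exponent homomorphism of the free group on one generator. -/
def unitExponent : FreeGroup Unit →* Multiplicative ℤ :=
  FreeGroup.lift fun _ => Multiplicative.ofAdd 1

theorem unitExponent_injective : Function.Injective unitExponent := by
  rw [injective_iff_map_eq_one]
  intro x hx
  obtain ⟨n, rfl⟩ := freeGroupUnitEquivInt.symm.surjective x
  change unitExponent (FreeGroup.of () ^ n) = 1 at hx
  have hn : n = 0 := by
    simpa [unitExponent, ← ofAdd_zsmul] using hx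
  subst hn
  rfl

open Classical in
/-- Left multiplication by the generator `i` on noncommutative power series over `ℤ` (functions on
words), modulo the relations that generators square to zero. -/
noncomputable def shift (i : ι) : Module.End ℤ (List ι → ℤ) where
  toFun f l := match l with
    | [] => 0
    | j :: l => if j = i ∧ l.head? ≠ some i then f l else 0
  map_add' f g := by
    ext l
    cases l with
    | nil => simp
    | cons j l => by_cases h : j = i ∧ l.head? ≠ some i <;> simp [h]
  map_smul' c f := by
    ext l
    cases l with
    | nil => simp
    | cons j l => by_cases h : j = i ∧ l.head? ≠ some i <;> simp [h]

@[simp]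
theorem shift_nil (i : ι) (f : List ι → ℤ) : shift i f [] = 0 := rfl

open Classical in
theorem shift_cons (i j : ι) (f : List ι → ℤ) (l : List ι) :
    shift i f (j :: l) = if j = i ∧ l.head? ≠ some i then f l else 0 := rfl

theorem shift_mul_shift (i : ι) : shift i * shift i = 0 := by
  ext f l
  rcases l with _ | ⟨j, _ | ⟨k, l⟩⟩
  · simp
  · simp only [Module.End.mul_apply, shift_cons, shift_nil, LinearMap.zero_apply, Pi.zero_apply]
    split_ifs <;> rfl
  · simp only [Module.End.mul_apply, shift_cons, LinearMap.zero_apply, Pi.zero_apply]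
    split_ifs <;> simp_all

/-- The representation of an infinite cyclic group sending the generator to `1 + shift i`. -/
noncomputable def magnusGen (i : ι) : Multiplicative ℤ →* Module.End ℤ (List ι → ℤ) where
  toFun n := 1 + n.toAdd • shift i
  map_one' := by simp
  map_mul' a b := by
    simp only [toAdd_mul, mul_add, add_mul, smul_mul_smul_comm, shift_mul_shift, add_smul,
      smul_zero, one_mul, mul_one]
    abel

/-- The Magnus representation of a free product of infinite cyclic groups. -/
noncomputable def magnus :
    Monoid.CoprodI (fun _ : ι => FreeGroup Unit) →* Module.End ℤ (List ι → ℤ) :=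
  Monoid.CoprodI.lift fun i => (magnusGen i).comp unitExponent

theorem magnus_of_apply (i : ι) (x : FreeGroup Unit) (f : List ι → ℤ) (l : List ι) :
    magnus (Monoid.CoprodI.of (i := i) x) f l =
      f l + (unitExponent x).toAdd * shift i f l := by
  simp [magnus, magnusGen]

/-- Operators raising the order of a power series by at least `k`. -/
def raising (ι : Type*) (k : ℕ) : AddSubgroup (Module.End ℤ (List ι → ℤ)) where
  carrier := {t | ∀ (n : ℕ) (f : List ι → ℤ), (∀ l : List ι, l.length < n → f l = 0) →
    ∀ l : List ι, l.length < n + k → t f l = 0}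
  zero_mem' := by simp
  add_mem' ha hb n f hf l hl := by simp [ha n f hf l hl, hb n f hf l hl]
  neg_mem' ha n f hf l hl := by simp [ha n f hf l hl]

theorem shift_mem_raising (i : ι) : shift i ∈ raising ι 1 := by
  intro n f hf l hl
  cases l with
  | nil => simp
  | cons j l => simp [shift_cons, hf l (by simpa using hl)]

theorem raising_antitone : Antitone (raising ι) :=
  fun _ _ hab _ ht n f hf l hl => ht n f hf l (by lia)

theorem one_mem_raising : 1 ∈ raising ι 0 := fun _ _ hf l hl => hf l hl

theorem mul_mem_raising (a b : ℕ) (x y : Module.End ℤ (List ι → ℤ)) (hx : x ∈ raising ι a)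
    (hy : y ∈ raising ι b) : x * y ∈ raising ι (a + b) :=
  fun n f hf l hl => hx (n + b) (y f) (hy n f hf) l (by lia)

theorem magnus_sub_one_mem_raising (g : Monoid.CoprodI (fun _ : ι => FreeGroup Unit)) :
    magnus g - 1 ∈ raising ι 1 := by
  induction g using Monoid.CoprodI.induction_on with
  | one => simp
  | of i x =>
    have : magnus (Monoid.CoprodI.of (i := i) x) - 1 = (unitExponent x).toAdd • shift i := by
      simp [magnus, magnusGen]
    rw [this]
    exact zsmul_mem (shift_mem_raising i) _
  | mul a b ha hb =>
    have : magnus (a * b) - 1 = (magnus a - 1) * (magnus b - 1) + (magnus a - 1)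
        + (magnus b - 1) := by
      rw [MonoidHom.map_mul]; noncomm_ring
    rw [this]
    exact add_mem (add_mem (raising_antitone one_le_two (mul_mem_raising 1 1 _ _ ha hb)) ha) hb

open Classical in
/-- The coefficient of `magnus w` at the list of indices of the reduced word `w` is nonzero, and
coefficients at longer lists vanish. -/
theorem magnus_word_prod (w : Monoid.CoprodI.Word (fun _ : ι => FreeGroup Unit)) :
    magnus w.prod (Pi.single [] 1) (w.toList.map Sigma.fst) ≠ 0 ∧
      ∀ l : List ι, w.toList.length < l.length → magnus w.prod (Pi.single [] 1) l = 0 := by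
  induction w using Monoid.CoprodI.Word.consRecOn with
  | empty =>
    refine ⟨?_, fun l hl => ?_⟩
    · rw [Monoid.CoprodI.Word.prod_empty]
      simp [Monoid.CoprodI.Word.empty]
    · have : l ≠ [] := by rintro rfl; simp at hl
      simp [this]
  | cons i x w hw hx ih =>
    obtain ⟨ih₁, ih₂⟩ := ih
    rw [Monoid.CoprodI.Word.prod_cons, MonoidHom.map_mul]
    refine ⟨?_, fun l hl => ?_⟩
    · have hexp : (unitExponent x).toAdd ≠ 0 :=
        fun h => hx (unitExponent_injective (by simpa using h))
      have hhead : (w.toList.map Sigma.fst).head? ≠ some i := by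
        rwa [List.head?_map]
      rw [Module.End.mul_apply, magnus_of_apply]
      simp only [Monoid.CoprodI.Word.cons, List.map_cons]
      rw [ih₂ _ (by simp), shift_cons, if_pos ⟨rfl, hhead⟩, zero_add]
      exact mul_ne_zero hexp ih₁
    · simp only [Monoid.CoprodI.Word.cons, List.length_cons] at hl
      rw [Module.End.mul_apply, magnus_of_apply, ih₂ l (by lia)]
      cases l with
      | nil => simp
      | cons j l => simp [shift_cons, ih₂ l (by simpa using hl)]

theorem residuallySolvable (ι : Type u) : ResiduallySolvable (FreeGroup ι) := by
  classical
  refine ResiduallySolvable.of_injective ?_ freeGroupEquivCoprodI.toMonoidHom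
    freeGroupEquivCoprodI.injective
  refine residuallySolvable_of_forall_notMem_derivedSeries fun g hg => ?_
  obtain ⟨w, rfl⟩ := Monoid.CoprodI.Word.equiv.symm.surjective g
  change w.prod ≠ 1 at hg
  refine ⟨w.toList.length, fun hmem => (magnus_word_prod w).1 ?_⟩
  have key := map_sub_one_mem_of_mem_derivedSeries magnus (raising ι) raising_antitone
    one_mem_raising mul_mem_raising magnus_sub_one_mem_raising _ _ hmem 0 (Pi.single [] 1)
    (by simp) (w.toList.map Sigma.fst) (by simp)
  have hne : w.toList.map Sigma.fst ≠ [] := by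
    intro h
    refine hg ?_
    rw [List.map_eq_nil_iff] at h
    simp [Monoid.CoprodI.Word.prod, h]
  change magnus w.prod _ _ - (Pi.single [] 1 : List ι → ℤ) _ = 0 at key
  rwa [Pi.single_eq_of_ne hne, sub_zero] at key

end FreeGroup

theorem MonoidHom.eq_of_eqOn_of_commutator_quotient_eq_top {A S : Type*} [Group A] [Group S]
    [Group.IsSolvable S] (C : Subgroup A) [C.Normal] (hperf : commutator (A ⧸ C) = ⊤)
    (f g : A →* S) (hfg : ∀ c ∈ C, f c = g c) : f = g := by
  obtain ⟨n, hn⟩ := (Group.isSolvable_def S).1 inferInstance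
  have hker (h : A →* S) {a : A} (ha : a ∈ derivedSeries A n) : h a = 1 := by
    have := map_derivedSeries_le_derivedSeries h n (Subgroup.mem_map_of_mem h ha)
    rwa [hn, Subgroup.mem_bot] at this
  have : Group.IsPerfect (A ⧸ C) := Group.isPerfect_def.2 hperf
  ext a
  have hmem : (a : A ⧸ C) ∈ (derivedSeries A n).map (QuotientGroup.mk' C) := by
    rw [map_derivedSeries_eq (QuotientGroup.mk'_surjective C), Group.IsPerfect.derivedSeries_eq_top]
    trivial
  obtain ⟨b, hb, hba⟩ := hmem
  have hc : b⁻¹ * a ∈ C := QuotientGroup.eq.1 hba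
  rw [← mul_inv_cancel_left b a, map_mul f, map_mul g, hker f hb, hker g hb, hfg _ hc]

namespace Double

variable {A : Type u} [Group A] (C : Subgroup A) (φ : A ≃* A)

theorem inl_eq_inr {c : A} (hc : c ∈ C) : inl C φ c = inr C φ (φ c) :=
  (Monoid.PushoutI.of_apply_eq_base (doubleMaps C φ) false ⟨c, hc⟩).trans
    (Monoid.PushoutI.of_apply_eq_base (doubleMaps C φ) true ⟨c, hc⟩).symm

theorem doubleMaps_injective (b : Bool) : Function.Injective (doubleMaps C φ b) := by
  cases b
  · exact C.subtype_injective
  · exact φ.injective.comp C.subtype_injective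

theorem mem_of_inl_eq_inr {a b : A} (h : inl C φ a = inr C φ b) : a ∈ C := by
  have hmem : inl C φ a ∈ (Monoid.PushoutI.base (doubleMaps C φ)).range := by
    rw [← Monoid.PushoutI.inf_of_range_eq_base_range (doubleMaps_injective C φ) Bool.false_ne_true]
    exact ⟨⟨a, rfl⟩, ⟨b, h.symm⟩⟩
  obtain ⟨c, hc⟩ := hmem
  rw [← Monoid.PushoutI.of_apply_eq_base (doubleMaps C φ) false] at hc
  have : (c : A) = a :=
    Monoid.PushoutI.of_injective (doubleMaps_injective C φ) false hc
  exact this ▸ c.2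

theorem not_residuallySolvable [C.Normal] (hC : C ≠ ⊤) (hperf : commutator (A ⧸ C) = ⊤) :
    ¬ ResiduallySolvable (Double C φ) := by
  intro h
  obtain ⟨a, ha⟩ : ∃ a, a ∉ C := by
    by_contra! hall
    exact hC ((Subgroup.eq_top_iff' C).2 hall)
  obtain ⟨S, _, f, hS, hf⟩ := h (inl C φ a * (inr C φ (φ a))⁻¹)
    fun h => ha (mem_of_inl_eq_inr C φ (mul_inv_eq_one.1 h))
  have : Group.IsSolvable S := hS
  have hcomp : f.comp (inl C φ) = (f.comp (inr C φ)).comp φ.toMonoidHom :=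
    MonoidHom.eq_of_eqOn_of_commutator_quotient_eq_top C hperf _ _
      fun c hc => congrArg f (inl_eq_inr C φ hc)
  refine hf ?_
  rw [map_mul, map_inv, mul_inv_eq_one]
  exact DFunLike.congr_fun hcomp a

/-- The action of `A` on the free group on `A ⧸ C` by permutation of the basis. -/
def permAut : A →* MulAut (FreeGroup (A ⧸ C)) :=
  MonoidHom.mk' (fun a => FreeGroup.freeGroupCongr (MulAction.toPerm a)) fun a b => by
    refine MulEquiv.toMonoidHom_injective (FreeGroup.ext_hom _ _ fun q => ?_)
    simp [mul_smul]

@[simp]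
theorem permAut_of (a : A) (q : A ⧸ C) :
    permAut C a (FreeGroup.of q) = FreeGroup.of (a • q) := by
  simp [permAut]

/-- The basis element of the free group on `A ⧸ C` given by the trivial coset, inside the
semidirect product. -/
def stable : FreeGroup (A ⧸ C) ⋊[permAut C] A :=
  SemidirectProduct.inl (FreeGroup.of ((1 : A) : A ⧸ C))

theorem inr_mul_stable (a : A) :
    (SemidirectProduct.inr a : FreeGroup (A ⧸ C) ⋊[permAut C] A) * stable C =
      SemidirectProduct.inl (FreeGroup.of (a : A ⧸ C)) * SemidirectProduct.inr a := by
  ext <;> simp [stable]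

/-- The embedding of the double into `FreeGroup (A ⧸ C) ⋊ A`, which conjugates the first copy of `A`
by a free generator. -/
def toSemidirect : Double C φ →* FreeGroup (A ⧸ C) ⋊[permAut C] A :=
  Monoid.PushoutI.lift
    (fun b => match b with
      | false => (MulAut.conj (stable C)⁻¹).toMonoidHom.comp SemidirectProduct.inr
      | true => SemidirectProduct.inr.comp φ.symm.toMonoidHom)
    (SemidirectProduct.inr.comp C.subtype) <| by
      rintro (_ | _)
      · ext1 c
        have hc : ((c : A) : A ⧸ C) = ((1 : A) : A ⧸ C) := by
          simp [QuotientGroup.eq]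
        simp [doubleMaps, mul_assoc, inr_mul_stable, hc]
        simp [stable]
      · ext1 c
        simp [doubleMaps]

theorem toSemidirect_inl (a : A) : toSemidirect C φ (inl C φ a) =
    (stable C)⁻¹ * SemidirectProduct.inr a * stable C := by
  simp [toSemidirect, inl]

theorem toSemidirect_inr (a : A) :
    toSemidirect C φ (inr C φ a) = SemidirectProduct.inr (φ.symm a) := by
  simp [toSemidirect, inr]

/-- The homomorphism to the double measuring the difference between the two copies of `A`. -/
def ofFree : FreeGroup (A ⧸ C) →* Double C φ :=
  FreeGroup.lift fun q => Quotient.liftOn' q (fun a => inl C φ a * (inr C φ (φ a))⁻¹) <| by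
    intro a b hab
    have hc := QuotientGroup.leftRel_apply.1 hab
    obtain ⟨c, rfl⟩ : ∃ c, b = a * c := ⟨a⁻¹ * b, by simp⟩
    rw [inv_mul_cancel_left] at hc
    simp [inl_eq_inr C φ hc]

theorem ofFree_of (a : A) :
    ofFree C φ (FreeGroup.of (a : A ⧸ C)) = inl C φ a * (inr C φ (φ a))⁻¹ := by
  simp only [ofFree, FreeGroup.lift_apply_of]
  rfl

/-- The endomorphism of the free group normalizing the trivial coset to `1`. -/
def normalize : FreeGroup (A ⧸ C) →* FreeGroup (A ⧸ C) :=
  FreeGroup.lift fun q => (FreeGroup.of ((1 : A) : A ⧸ C))⁻¹ * FreeGroup.of q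

theorem ofFree_normalize (w : FreeGroup (A ⧸ C)) : ofFree C φ (normalize C w) = ofFree C φ w := by
  suffices (ofFree C φ).comp (normalize C) = ofFree C φ from DFunLike.congr_fun this w
  ext q
  simp [normalize, ofFree_of]

theorem toSemidirect_ofFree (w : FreeGroup (A ⧸ C)) :
    toSemidirect C φ (ofFree C φ w) = SemidirectProduct.inl (normalize C w) := by
  suffices (toSemidirect C φ).comp (ofFree C φ) = SemidirectProduct.inl.comp (normalize C) from
    DFunLike.congr_fun this w
  refine FreeGroup.ext_hom _ _ fun q => ?_
  obtain ⟨a, rfl⟩ := QuotientGroup.mk_surjective q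
  simp only [MonoidHom.comp_apply, ofFree_of, map_mul, map_inv, toSemidirect_inl,
    toSemidirect_inr, mul_assoc, inr_mul_stable, normalize, FreeGroup.lift_apply_of]
  simp [stable]

theorem exists_conj_ofFree (a : A) (w : FreeGroup (A ⧸ C)) :
    ∃ w', inr C φ (φ a) * ofFree C φ w = ofFree C φ w' * inr C φ (φ a) := by
  let σ : FreeGroup (A ⧸ C) →* FreeGroup (A ⧸ C) :=
    FreeGroup.lift fun q => (FreeGroup.of (a : A ⧸ C))⁻¹ * FreeGroup.of (a • q)
  have h : (MulAut.conj (inr C φ (φ a))).toMonoidHom.comp (ofFree C φ) = (ofFree C φ).comp σ := by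
    refine FreeGroup.ext_hom _ _ fun q => ?_
    obtain ⟨b, rfl⟩ := QuotientGroup.mk_surjective q
    have hsmul : a • (b : A ⧸ C) = ((a * b : A) : A ⧸ C) := rfl
    simp [σ, ofFree_of, hsmul, mul_assoc]
  exact ⟨σ w, eq_mul_of_mul_inv_eq (DFunLike.congr_fun h w)⟩

theorem exists_eq_ofFree_mul_inr (x : Double C φ) :
    ∃ w a, x = ofFree C φ w * inr C φ (φ a) := by
  induction x using Monoid.PushoutI.induction_on with
  | of i g =>
    cases i
    · refine ⟨FreeGroup.of (g : A ⧸ C), g, ?_⟩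
      rw [ofFree_of, inv_mul_cancel_right]
      rfl
    · exact ⟨1, φ.symm g, by simp [inr]⟩
  | base c =>
    refine ⟨1, c, ?_⟩
    rw [← Monoid.PushoutI.of_apply_eq_base (doubleMaps C φ) true]
    simp [inr, doubleMaps]
  | mul x y hx hy =>
    obtain ⟨v, a, rfl⟩ := hx
    obtain ⟨w, b, rfl⟩ := hy
    obtain ⟨w', hw'⟩ := exists_conj_ofFree C φ a w
    refine ⟨v * w', a * b, ?_⟩
    rw [mul_assoc, ← mul_assoc (inr C φ (φ a)), hw']
    simp [mul_assoc]

theorem toSemidirect_injective : Function.Injective (toSemidirect C φ) := by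
  rw [injective_iff_map_eq_one]
  intro x hx
  obtain ⟨w, a, rfl⟩ := exists_eq_ofFree_mul_inr C φ x
  rw [map_mul, toSemidirect_ofFree, toSemidirect_inr, φ.symm_apply_apply] at hx
  have ha : a = 1 := by simpa using congrArg SemidirectProduct.right hx
  have hw : normalize C w = 1 := by simpa using congrArg SemidirectProduct.left hx
  rw [← ofFree_normalize, hw, ha]
  simp

/-- The retraction of the double onto `A`, up to the twist by `φ`. -/
def fold : Double C φ →* A := SemidirectProduct.rightHom.comp (toSemidirect C φ)

theorem residuallySolvable_ker_fold : ResiduallySolvable (fold C φ).ker := by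
  have hright (x : (fold C φ).ker) : (toSemidirect C φ x).right = 1 := x.2
  let f : (fold C φ).ker →* FreeGroup (A ⧸ C) :=
    MonoidHom.mk' (fun x => (toSemidirect C φ x).left) fun x y => by simp [hright]
  refine (FreeGroup.residuallySolvable (A ⧸ C)).of_injective f fun x y hxy => ?_
  exact Subtype.ext (toSemidirect_injective C φ
    (SemidirectProduct.ext hxy ((hright x).trans (hright y).symm)))

end Double

/-- **Theorem (neg-double).** If `A` is a finitely generated residually solvable group and `C`
is a proper normal subgroup of `A` with `A/C` perfect, then the double `D = A ∗_{C = φ(C)} A`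
is meta-residually-solvable but **not** residually solvable. -/
theorem double_meta_but_not_residually_solvable {A : Type u} [Group A] [Group.FG A]
    (hA : ResiduallySolvable A) (C : Subgroup A) [hCn : C.Normal] (hC : C ≠ ⊤)
    (hperf : commutator (A ⧸ C) = ⊤) (φ : A ≃* A) :
    (∃ N : Subgroup (Double C φ), ∃ _ : N.Normal,
      ResiduallySolvable N ∧ ResiduallySolvable (Double C φ ⧸ N)) ∧
    ¬ ResiduallySolvable (Double C φ) := by
  exact ⟨⟨(Double.fold C φ).ker, inferInstance, Double.residuallySolvable_ker_fold C φ,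
    hA.of_injective _ (QuotientGroup.kerLift_injective (Double.fold C φ))⟩,
    Double.not_residuallySolvable C φ hC hperf⟩
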